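/- The kissing number in dimension 25 is at most 278083: every finite set of unit vectors x_1, …, x_N in ℝ^{25} satisfying ⟨x_i, x_j⟩ ≤ 1/2 for all i ≠ j has N ≤ 278083. -/

import Mathlib

open scoped RealInnerProductSpace BigOperators

/-- The coefficient of `t ^ (k - 2 * m)` in the monic Gegenbauer polynomial of degree `k`
attached to the unit sphere of `ℝⁿ`. -/
noncomputable def gegenbauerCoeff (n k : ℕ) : ℕ → ℝ
  | 0 => 1
  | m + 1 => -(((k - 2 * m) * (k - 2 * m - 1) : ℝ) /
      (2 * (m + 1) * (2 * (k - 2 * (m + 1)) + 2 * m + n))) * gegenbauerCoeff n k m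

/-- The monic Gegenbauer polynomial of degree `k` attached to the unit sphere of `ℝⁿ`. -/
noncomputable def gegenbauer (n k : ℕ) (t : ℝ) : ℝ :=
  ∑ m ∈ Finset.range (k / 2 + 1), gegenbauerCoeff n k m * t ^ (k - 2 * m)

theorem gegenbauerCoeff_succ_mul {n k m : ℕ} (hn : 0 < n) (hm : 2 * (m + 1) ≤ k) :
    gegenbauerCoeff n k (m + 1) * (2 * (m + 1) * (2 * (k - 2 * (m + 1)) + 2 * m + n)) =
      -((k - 2 * m) * (k - 2 * m - 1) * gegenbauerCoeff n k m) := by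
  have hm' : (2 * (m + 1) : ℝ) ≤ k := by exact_mod_cast hm
  have hn' : (0 : ℝ) < n := by exact_mod_cast hn
  have h : (0 : ℝ) < 2 * (k - 2 * (m + 1)) + 2 * m + n := by
    have : (0 : ℝ) ≤ m := m.cast_nonneg
    linarith
  rw [gegenbauerCoeff]
  generalize (2 * (k - 2 * (m + 1)) + 2 * m + n : ℝ) = e at h ⊢
  field_simp

section Fischer

open MvPolynomial

variable {σ : Type*} [Fintype σ]

/-- The Fischer form `∑ s! pₛ qₛ` on real polynomials, as a bilinear map. -/
noncomputable def fischer : MvPolynomial σ ℝ →ₗ[ℝ] MvPolynomial σ ℝ →ₗ[ℝ] ℝ :=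
  (basisMonomials σ ℝ).constr ℝ fun s => (∏ i, ((s i).factorial : ℝ)) • lcoeff ℝ s

theorem fischer_monomial (s : σ →₀ ℕ) (a : ℝ) (q : MvPolynomial σ ℝ) :
    fischer (monomial s a) q = a * ((∏ i, ((s i).factorial : ℝ)) * coeff s q) := by
  have h : fischer (monomial s (1 : ℝ)) = (∏ i, ((s i).factorial : ℝ)) • lcoeff ℝ s := by
    have := (basisMonomials σ ℝ).constr_basis ℝ
      (fun s => (∏ i, ((s i).factorial : ℝ)) • lcoeff ℝ s) s
    rwa [coe_basisMonomials] at this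
  have h' : monomial s a = a • monomial s (1 : ℝ) := by rw [smul_monomial, smul_eq_mul, mul_one]
  rw [h', map_smul, h]
  rfl

theorem fischer_self_nonneg (p : MvPolynomial σ ℝ) : 0 ≤ fischer p p := by
  have h : fischer p p =
      ∑ s ∈ p.support, coeff s p * ((∏ i, ((s i).factorial : ℝ)) * coeff s p) := by
    conv_lhs => enter [1]; rw [p.as_sum]
    simp only [map_sum, LinearMap.sum_apply, fischer_monomial]
  rw [h]
  refine Finset.sum_nonneg fun s _ => ?_
  have : 0 ≤ ∏ i, ((s i).factorial : ℝ) := by positivity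
  nlinarith [mul_nonneg this (mul_self_nonneg (coeff s p))]

/-- Multiplication by a variable is adjoint to differentiation. -/
theorem fischer_X_mul (i : σ) (p q : MvPolynomial σ ℝ) :
    fischer (X i * p) q = fischer p (pderiv i q) := by
  classical
  induction p using MvPolynomial.induction_on' with
  | add p₁ p₂ h₁ h₂ => simp only [mul_add, map_add, LinearMap.add_apply, h₁, h₂]
  | monomial s a =>
    have hX : X i * monomial s a = monomial (s + Finsupp.single i 1) a := by
      rw [mul_comm, X, monomial_mul, mul_one]
    have hf : ∏ j, (((s + Finsupp.single i 1 : σ →₀ ℕ) j).factorial : ℝ) =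
        (∏ j, ((s j).factorial : ℝ)) * (s i + 1) := by
      have h : ∀ j, (((s + Finsupp.single i 1 : σ →₀ ℕ) j).factorial : ℝ) =
          ((s j).factorial : ℝ) * if i = j then (s j + 1 : ℝ) else 1 := by
        intro j
        split_ifs with hij
        · subst hij
          simp [Nat.factorial_succ, mul_comm]
        · simp [Finsupp.single_eq_of_ne' hij]
      rw [Finset.prod_congr rfl fun j _ => h j, Finset.prod_mul_distrib, Finset.prod_ite_eq]
      simp
    rw [hX, fischer_monomial, fischer_monomial, coeff_pderiv, hf]
    ring

theorem fischer_C_mul (a : ℝ) (p q : MvPolynomial σ ℝ) :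
    fischer (C a * p) q = a * fischer p q := by
  rw [C_mul', map_smul, LinearMap.smul_apply, smul_eq_mul]

/-- The linear form `y ↦ ∑ i, x i * y i`. -/
noncomputable def linearForm (x : σ → ℝ) : MvPolynomial σ ℝ := ∑ i, C (x i) * X i

/-- The quadratic form `y ↦ ∑ i, y i ^ 2`. -/
noncomputable def normSqForm (σ : Type*) [Fintype σ] : MvPolynomial σ ℝ := ∑ i, X i ^ 2

/-- The Laplacian on polynomials. -/
noncomputable def laplace (q : MvPolynomial σ ℝ) : MvPolynomial σ ℝ :=
  ∑ i, pderiv i (pderiv i q)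

theorem fischer_linearForm_mul (x : σ → ℝ) (p q : MvPolynomial σ ℝ) :
    fischer (linearForm x * p) q = fischer p (∑ i, C (x i) * pderiv i q) := by
  simp only [linearForm, Finset.sum_mul, map_sum, LinearMap.sum_apply, C_mul', smul_mul_assoc,
    map_smul, LinearMap.smul_apply, fischer_X_mul]

theorem fischer_normSqForm_mul (p q : MvPolynomial σ ℝ) :
    fischer (normSqForm σ * p) q = fischer p (laplace q) := by
  simp only [normSqForm, laplace, Finset.sum_mul, map_sum, LinearMap.sum_apply, pow_two, mul_assoc,
    fischer_X_mul]

theorem fischer_linearForm_pow (x : σ → ℝ) (k : ℕ) (q : MvPolynomial σ ℝ)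
    (hq : q.IsHomogeneous k) : fischer (linearForm x ^ k) q = k.factorial * eval x q := by
  induction k generalizing q with
  | zero =>
    rw [← totalDegree_zero_iff_isHomogeneous, totalDegree_eq_zero_iff_eq_C] at hq
    rw [hq, pow_zero, ← C_1, ← monomial_zero', fischer_monomial]
    simp
  | succ k ih =>
    rw [pow_succ', fischer_linearForm_mul, ih]
    · have h := congrArg (eval x) hq.sum_X_mul_pderiv
      simp only [map_sum, map_mul, eval_X, nsmul_eq_mul, eval_C, map_natCast] at h ⊢
      rw [h, Nat.factorial_succ]
      push_cast
      ring
    · refine IsHomogeneous.sum _ _ _ fun i _ => ?_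
      simpa using (isHomogeneous_C σ (x i)).mul hq.pderiv

theorem isHomogeneous_linearForm (x : σ → ℝ) : (linearForm x).IsHomogeneous 1 :=
  IsHomogeneous.sum _ _ _ fun i _ => by
    simpa using (isHomogeneous_C σ (x i)).mul (isHomogeneous_X ℝ i)

theorem isHomogeneous_normSqForm : (normSqForm σ).IsHomogeneous 2 :=
  IsHomogeneous.sum _ _ _ fun i _ => by simpa using (isHomogeneous_X ℝ i).pow 2

theorem pderiv_linearForm (x : σ → ℝ) (i : σ) : pderiv i (linearForm x) = C (x i) := by
  classical
  simp [linearForm, pderiv_X, Pi.single_apply]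

theorem pderiv_normSqForm (i : σ) : pderiv i (normSqForm σ) = 2 * X i := by
  classical
  simp [normSqForm, pderiv_X, Pi.single_apply]

theorem laplace_linearForm_pow_mul (x : σ → ℝ) (hx : ∑ i, x i ^ 2 = 1) (a m : ℕ) :
    laplace (linearForm x ^ a * normSqForm σ ^ m) =
      C (a * (a - 1) : ℝ) * (linearForm x ^ (a - 2) * normSqForm σ ^ m) +
      C (2 * m * (2 * a + 2 * (m - 1) + Fintype.card σ) : ℝ) *
        (linearForm x ^ a * normSqForm σ ^ (m - 1)) := by
  have h₁ : ∑ i, (C (x i) ^ 2 : MvPolynomial σ ℝ) = 1 := by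
    simp only [← C_pow, ← map_sum, hx, C_1]
  have h₂ : ∑ i, C (x i) * X i = linearForm x := rfl
  have h₃ : ∑ i, X i ^ 2 = normSqForm σ := rfl
  have key : laplace (linearForm x ^ a * normSqForm σ ^ m) =
      (a : MvPolynomial σ ℝ) * ((a - 1 : ℕ) : MvPolynomial σ ℝ) *
        linearForm x ^ (a - 1 - 1) * normSqForm σ ^ m * ∑ i, (C (x i) ^ 2 : MvPolynomial σ ℝ) +
      4 * (a : MvPolynomial σ ℝ) * (m : MvPolynomial σ ℝ) * linearForm x ^ (a - 1) *
        normSqForm σ ^ (m - 1) * ∑ i, C (x i) * X i +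
      4 * (m : MvPolynomial σ ℝ) * ((m - 1 : ℕ) : MvPolynomial σ ℝ) * linearForm x ^ a *
        normSqForm σ ^ (m - 1 - 1) * ∑ i, X i ^ 2 +
      2 * (m : MvPolynomial σ ℝ) * linearForm x ^ a * normSqForm σ ^ (m - 1) * ∑ _i : σ, 1 := by
    simp only [laplace, Finset.mul_sum, ← Finset.sum_add_distrib]
    refine Finset.sum_congr rfl fun i _ => ?_
    have h2 : pderiv i (2 : MvPolynomial σ ℝ) = 0 := (pderiv i).map_natCast 2
    simp only [pderiv_mul, pderiv_pow, pderiv_linearForm, pderiv_normSqForm, map_add, pderiv_X_self,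
      pderiv_C, Derivation.map_natCast, h2]
    ring
  rw [key, h₁, h₂, h₃]
  have ha : (a : MvPolynomial σ ℝ) * linearForm x ^ (a - 1) * linearForm x
      = a * linearForm x ^ a := by
    cases a <;> simp [pow_succ, mul_assoc]
  have hm : (m : MvPolynomial σ ℝ) * ((m - 1 : ℕ) : MvPolynomial σ ℝ) *
      normSqForm σ ^ (m - 1 - 1) * normSqForm σ =
        m * ((m - 1 : ℕ) : MvPolynomial σ ℝ) * normSqForm σ ^ (m - 1) := by
    rcases m with _ | _ | m <;> simp [pow_succ, mul_assoc]
  have ca : C (a * (a - 1) : ℝ) = ((a : MvPolynomial σ ℝ) * ((a - 1 : ℕ) : MvPolynomial σ ℝ)) := by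
    cases a <;> simp
  have cm : (C (m * (m - 1) : ℝ) : MvPolynomial σ ℝ) = m * ((m - 1 : ℕ) : MvPolynomial σ ℝ) := by
    cases m <;> simp
  have cm' : C (2 * m * (2 * a + 2 * (m - 1) + Fintype.card σ) : ℝ) =
      (4 * a * m + 4 * (m * ((m - 1 : ℕ) : MvPolynomial σ ℝ)) + 2 * m * Fintype.card σ :
        MvPolynomial σ ℝ) := by
    rw [← cm]
    have : (2 * m * (2 * a + 2 * (m - 1) + Fintype.card σ) : ℝ) =
      4 * a * m + 4 * (m * (m - 1)) + 2 * m * Fintype.card σ := by ring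
    rw [this]
    simp only [map_add, map_mul, map_natCast, map_ofNat]
  rw [ca, cm', Nat.sub_sub]
  simp only [Finset.sum_const, Finset.card_univ, nsmul_eq_mul, mul_one]
  linear_combination (4 * m * normSqForm σ ^ (m - 1)) * ha + 4 * linearForm x ^ a * hm

/-- The zonal harmonic of degree `k` with pole `x`. -/
noncomputable def zonal (k : ℕ) (x : σ → ℝ) : MvPolynomial σ ℝ :=
  ∑ m ∈ Finset.range (k / 2 + 1),
    C (gegenbauerCoeff (Fintype.card σ) k m) * (linearForm x ^ (k - 2 * m) * normSqForm σ ^ m)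

theorem isHomogeneous_zonal (k : ℕ) (x : σ → ℝ) : (zonal k x).IsHomogeneous k := by
  refine IsHomogeneous.sum _ _ _ fun m hm => ?_
  have hm' : 2 * m ≤ k := by have := Finset.mem_range.1 hm; omega
  have h := (isHomogeneous_C σ (gegenbauerCoeff (Fintype.card σ) k m)).mul
    (((isHomogeneous_linearForm x).pow (k - 2 * m)).mul
      ((isHomogeneous_normSqForm (σ := σ)).pow m))
  convert h using 1
  omega

theorem laplace_zonal [Nonempty σ] (k : ℕ) (x : σ → ℝ) (hx : ∑ i, x i ^ 2 = 1) :
    laplace (zonal k x) = 0 := by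
  have h : laplace (zonal k x) = ∑ m ∈ Finset.range (k / 2 + 1),
      C (gegenbauerCoeff (Fintype.card σ) k m) *
        laplace (linearForm x ^ (k - 2 * m) * normSqForm σ ^ m) := by
    simp only [laplace, zonal, map_sum, pderiv_C_mul, Finset.mul_sum]
    exact Finset.sum_comm
  simp only [h, laplace_linearForm_pow_mul x hx, mul_add (C _ : MvPolynomial σ ℝ),
    Finset.sum_add_distrib]
  rw [Finset.sum_range_succ, Finset.sum_range_succ' (n := k / 2), add_add_add_comm,
    ← Finset.sum_add_distrib]
  have h_top : C (((k - 2 * (k / 2) : ℕ) : ℝ) * ((k - 2 * (k / 2) : ℕ) - 1)) =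
      (0 : MvPolynomial σ ℝ) := by
    obtain h | h : k - 2 * (k / 2) = 0 ∨ k - 2 * (k / 2) = 1 := by omega
    all_goals simp [h]
  rw [h_top]
  simp only [Nat.cast_zero, mul_zero, zero_mul, map_zero, add_zero]
  refine Finset.sum_eq_zero fun m hm => ?_
  have hm' : 2 * (m + 1) ≤ k := by have := Finset.mem_range.1 hm; omega
  have hc := gegenbauerCoeff_succ_mul (Fintype.card_pos (α := σ)) hm'
  have e₁ : k - 2 * m - 2 = k - 2 * (m + 1) := by omega
  rw [e₁, Nat.add_sub_cancel, ← mul_assoc (C _) (C _), ← mul_assoc (C _) (C _), ← C_mul, ← C_mul,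
    ← add_mul, ← C_add, Nat.cast_sub hm', Nat.cast_sub (by omega : 2 * m ≤ k)]
  push_cast
  have : gegenbauerCoeff (Fintype.card σ) k m * ((k - 2 * m) * (k - 2 * m - 1)) +
      gegenbauerCoeff (Fintype.card σ) k (m + 1) *
        (2 * (m + 1) * (2 * (k - 2 * (m + 1)) + 2 * (m + 1 - 1) + Fintype.card σ)) = 0 := by
    linear_combination hc
  rw [this, C_0, zero_mul]

theorem fischer_zonal [Nonempty σ] (k : ℕ) (x y : σ → ℝ) (hx : ∑ i, x i ^ 2 = 1)
    (hy : ∑ i, y i ^ 2 = 1) :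
    fischer (zonal k x) (zonal k y) =
      k.factorial * gegenbauer (Fintype.card σ) k (∑ i, x i * y i) := by
  have h : fischer (zonal k x) (zonal k y) = fischer (linearForm x ^ k) (zonal k y) := by
    conv_lhs => enter [1]; rw [zonal]
    rw [Finset.sum_range_succ']
    simp only [map_add, map_sum, LinearMap.add_apply, LinearMap.sum_apply, fischer_C_mul]
    rw [Finset.sum_eq_zero, zero_add]
    · simp [gegenbauerCoeff]
    · intro m _
      rw [pow_succ', mul_left_comm, fischer_normSqForm_mul, laplace_zonal k y hy, map_zero,
        mul_zero]
  rw [h, fischer_linearForm_pow x k _ (isHomogeneous_zonal k y)]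
  congr 1
  simp only [zonal, gegenbauer, linearForm, normSqForm, map_sum, map_mul, map_pow, eval_C, eval_X,
    hx, one_pow, mul_one, mul_comm (y _)]

/-- Gegenbauer polynomials are positive definite on the sphere. -/
theorem sum_gegenbauer_nonneg [Nonempty σ] {ι : Type*} [Fintype ι] (k : ℕ) (x : ι → σ → ℝ)
    (hx : ∀ i, ∑ s, x i s ^ 2 = 1) :
    0 ≤ ∑ i, ∑ j, gegenbauer (Fintype.card σ) k (∑ s, x i s * x j s) := by
  have h := fischer_self_nonneg (∑ i, zonal k (x i))
  simp only [map_sum, LinearMap.sum_apply, fischer_zonal k _ _ (hx _) (hx _),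
    ← Finset.mul_sum] at h
  rw [Finset.sum_comm] at h
  exact nonneg_of_mul_nonneg_right h (by positivity)

end Fischer

/-- The quotient of `kissingPoly` by `-3 / 4 - t`. -/
noncomputable def capCofactor (t : ℝ) : ℝ :=
  (1 / 2 - t) * ((t + 0.514) * (t + 0.3686) * (t + 0.2068) * (t - 0.02) * (t - 0.2582)) ^ 2 *
    (1.4366 - 0.7933 * t - 1.1227 * t ^ 2 + t ^ 3)

/-- The auxiliary polynomial for the linear programming bound in dimension 25: it is nonpositive on
`[-3 / 4, 1 / 2]` and its values on `[-1, -3 / 4]` are small. -/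
noncomputable def kissingPoly (t : ℝ) : ℝ := (-3 / 4 - t) * capCofactor t

theorem capCofactor_nonneg {t : ℝ} (h₁ : -1 ≤ t) (h₂ : t ≤ 1 / 2) : 0 ≤ capCofactor t := by
  have h : 0 ≤ 1.4366 - 0.7933 * t - 1.1227 * t ^ 2 + t ^ 3 := by
    nlinarith [mul_nonneg (sub_nonneg.2 h₂) (sq_nonneg (t + 1)),
      mul_nonneg (sub_nonneg.2 h₂) (neg_le_iff_add_nonneg.1 h₁)]
  have h' : 0 ≤ 1 / 2 - t := by linarith
  unfold capCofactor
  positivity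

theorem kissingPoly_nonpos {t : ℝ} (h₁ : -(3 / 4) ≤ t) (h₂ : t ≤ 1 / 2) : kissingPoly t ≤ 0 :=
  mul_nonpos_of_nonpos_of_nonneg (by linarith) (capCofactor_nonneg (by linarith) h₂)

theorem capCofactor_le {t : ℝ} (h₁ : -1 ≤ t) (h₂ : t ≤ -(3 / 4)) :
    capCofactor t ≤ 5 * 0.0051 := by
  have key : ∀ p q : ℝ, 0 ≤ p → 0 ≤ q → 0 ≤
      1854561933474587017272592669731211 / 291038304567337036132812500 * p ^ 0 * q ^ 14 +
      126353635097059530464300485587386631 / 1455191522836685180664062500 * p ^ 1 * q ^ 13 +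
      1583368232245054603306528295014301201 / 2910383045673370361328125000 * p ^ 2 * q ^ 12 +
      120518671868673329652836844182390883 / 58207660913467407226562500 * p ^ 3 * q ^ 11 +
      123915303804857655726303997156948819823 / 23283064365386962890625000000 * p ^ 4 * q ^ 10 +
      45213542572340679963806750524893176597 / 4656612873077392578125000000 * p ^ 5 * q ^ 9 +
      74732160250472946482121176317381917633 / 5820766091346740722656250000 * p ^ 6 * q ^ 8 +
      143330882546150931061250168788408333383 / 11641532182693481445312500000 * p ^ 7 * q ^ 7 +
      39069225637150889827024596272021084091 / 4656612873077392578125000000 * p ^ 8 * q ^ 6 +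
      89838480682915119669298539347300185941 / 23283064365386962890625000000 * p ^ 9 * q ^ 5 +
      2477559988159269973999265463031753503 / 2328306436538696289062500000 * p ^ 10 * q ^ 4 +
      734351554789988392706168650224053109 / 5820766091346740722656250000 * p ^ 11 * q ^ 3 +
      9514076601481653171270888659255451 / 2910383045673370361328125000 * p ^ 12 * q ^ 2 +
      1149467333220888848749424359721553 / 145519152283668518066406250 * p ^ 13 * q ^ 1 +
      957972846159040129674704377305312 / 363797880709171295166015625 * p ^ 14 * q ^ 0 := by
    intro p q hp hq
    positivity
  refine sub_nonneg.1 ((key (-(3 / 4) - t) (t + 1) (by linarith) (by linarith)).trans_eq ?_)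
  simp only [capCofactor]
  ring

theorem capCofactor_le_of_neg_23_div_25_le {t : ℝ} (h₁ : -(23 / 25) ≤ t) (h₂ : t ≤ -(3 / 4)) :
    capCofactor t ≤ 4.308 * 0.0051 := by
  have key : ∀ p q : ℝ, 0 ≤ p → 0 ≤ q → 0 ≤
      1578843183474587017272592669731211 / 1315451769995319757812500 * p ^ 0 * q ^ 14 +
      2704058666895780747565760150035050887 / 164431471249414969726562500 * p ^ 1 * q ^ 13 +
      171114904153016645592661798276255580589 / 1644314712494149697265625000 * p ^ 2 * q ^ 12 +
      41377467917814018331175535057390857176171 / 102769669530884356079101562500 * p ^ 3 * q ^ 11 +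
      1746832911975811018848909570642043471529223 / 1644314712494149697265625000000 * p ^ 4 * q ^ 10 +
      3318599795286296634547595609535368792063481 / 1644314712494149697265625000000 * p ^ 5 * q ^ 9 +
      1167332591164213171694651197495939970270331 / 411078678123537424316406250000 * p ^ 6 * q ^ 8 +
      2463310385861717904485455676750642828622903 / 822157356247074848632812500000 * p ^ 7 * q ^ 7 +
      3899718876844027085847263791408044609253551 / 1644314712494149697265625000000 * p ^ 8 * q ^ 6 +
      2290681752349180361002107304761064706617957 / 1644314712494149697265625000000 * p ^ 9 * q ^ 5 +
      487267622217407928249823789857266550712103 / 822157356247074848632812500000 * p ^ 10 * q ^ 4 +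
      71892637895551037455538288367854920001781 / 411078678123537424316406250000 * p ^ 11 * q ^ 3 +
      6824073824466941906254301237799703653007 / 205539339061768712158203125000 * p ^ 12 * q ^ 2 +
      36213164321524242933008757890376132549 / 10276966953088435607910156250 * p ^ 13 * q ^ 1 +
      3884436696643532973382091926102796556 / 25692417382721089019775390625 * p ^ 14 * q ^ 0 := by
    intro p q hp hq
    positivity
  refine sub_nonneg.1 ((key (-(3 / 4) - t) (t + 23 / 25) (by linarith) (by linarith)).trans_eq ?_)
  simp only [capCofactor]
  ring

theorem capCofactor_le_of_neg_4_div_5_le {t : ℝ} (h₁ : -(4 / 5) ≤ t) (h₂ : t ≤ -(3 / 4)) :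
    capCofactor t ≤ 1.2 * 0.0051 := by
  have key : ∀ p q : ℝ, 0 ≤ p → 0 ≤ q → 0 ≤
      340499433474587017272592669731211 / 47683715820312500 * p ^ 0 * q ^ 14 +
      115709101469943895300626433112125711 / 1192092895507812500 * p ^ 1 * q ^ 13 +
      1456329231745846548616545613477788597 / 2384185791015625000 * p ^ 2 * q ^ 12 +
      70273296232848333512036200368252973667 / 29802322387695312500 * p ^ 3 * q ^ 11 +
      2973270288944414706420624295216707937827 / 476837158203125000000 * p ^ 4 * q ^ 10 +
      1138937258329769669831500869151434013077 / 95367431640625000000 * p ^ 5 * q ^ 9 +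
      203544245524236350527529458616025886767 / 11920928955078125000 * p ^ 6 * q ^ 8 +
      882064633557439881526625071039290964971 / 47683715820312500000 * p ^ 7 * q ^ 7 +
      7269950177915717579749981790758351910739 / 476837158203125000000 * p ^ 8 * q ^ 6 +
      4530975838168336700618407675814772809909 / 476837158203125000000 * p ^ 9 * q ^ 5 +
      209888672671802153390500308521816725781 / 47683715820312500000 * p ^ 10 * q ^ 4 +
      34967367964955909854412002338366746289 / 23841857910156250000 * p ^ 11 * q ^ 3 +
      3950332364402844399250053526989601369 / 11920928955078125000 * p ^ 12 * q ^ 2 +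
      674574699074765656013513989234332681 / 14901161193847656250 * p ^ 13 * q ^ 1 +
      20897586984510326088710272203007788 / 7450580596923828125 * p ^ 14 * q ^ 0 := by
    intro p q hp hq
    positivity
  refine sub_nonneg.1 ((key (-(3 / 4) - t) (t + 4 / 5) (by linarith) (by linarith)).trans_eq ?_)
  simp only [capCofactor]
  ring

theorem kissingPoly_le_of_neg_19_div_20_le {t : ℝ} (h₁ : -(19 / 20) ≤ t) (h₂ : t ≤ -(3 / 4)) :
    kissingPoly t ≤ 0.93 * 0.0051 := by
  have key : ∀ p q : ℝ, 0 ≤ p → 0 ≤ q → 0 ≤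
      9263671875 / 64 * p ^ 0 * q ^ 15 +
      27653390058474587017272592669731211 / 12800000000000000000000000 * p ^ 1 * q ^ 14 +
      2400697992553229606533141714615365647 / 160000000000000000000000000 * p ^ 2 * q ^ 13 +
      4111771813134538780138195251015448617 / 64000000000000000000000000 * p ^ 3 * q ^ 12 +
      378755554894120972809565884293843440247 / 2000000000000000000000000000 * p ^ 4 * q ^ 11 +
      3249713036074592666985849686742557341803 / 8000000000000000000000000000 * p ^ 5 * q ^ 10 +
      522554366767997349956266919367028522749 / 800000000000000000000000000 * p ^ 6 * q ^ 9 +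
      1278036047323331282017170799687747662249 / 1600000000000000000000000000 * p ^ 7 * q ^ 8 +
      149019200662441390645044233435502458901 / 200000000000000000000000000 * p ^ 8 * q ^ 7 +
      4210428047495234392000838899909901287881 / 8000000000000000000000000000 * p ^ 9 * q ^ 6 +
      1104952499319600470147632634442166518313 / 4000000000000000000000000000 * p ^ 10 * q ^ 5 +
      166500203384089134207672114214998874363 / 1600000000000000000000000000 * p ^ 11 * q ^ 4 +
      10598798551103369782684445983789295451 / 400000000000000000000000000 * p ^ 12 * q ^ 3 +
      6548872545616823166665884740370455293 / 1600000000000000000000000000 * p ^ 13 * q ^ 2 +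
      1234309394951605998824608315256602959 / 4000000000000000000000000000 * p ^ 14 * q ^ 1 +
      54815561943824528660202523601105223 / 8000000000000000000000000000 * p ^ 15 * q ^ 0 := by
    intro p q hp hq
    positivity
  refine sub_nonneg.1 ((key (-(3 / 4) - t) (t + 19 / 20) (by linarith) (by linarith)).trans_eq ?_)
  simp only [kissingPoly, capCofactor]
  ring

theorem kissingPoly_le_of_le_neg_19_div_20 {t : ℝ} (h₁ : -1 ≤ t) (h₂ : t ≤ -(19 / 20)) :
    kissingPoly t ≤ 0.0051 := by
  have key : ∀ p q : ℝ, 0 ≤ p → 0 ≤ q → 0 ≤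
      141973765068824528660202523601105223 / 7450580596923828125 * p ^ 0 * q ^ 15 +
      6872040543383627651865972639569685807 / 29802322387695312500 * p ^ 1 * q ^ 14 +
      7512883939369933186545794200941453629 / 5960464477539062500 * p ^ 2 * q ^ 13 +
      48899545495715322660244357908498203897 / 11920928955078125000 * p ^ 3 * q ^ 12 +
      210804798976119786587566535849772538003 / 23841857910156250000 * p ^ 4 * q ^ 11 +
      6401635934872659643503228060669366612239 / 476837158203125000000 * p ^ 5 * q ^ 10 +
      7358420401454162502884581565771428529429 / 476837158203125000000 * p ^ 6 * q ^ 9 +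
      370310868808538224535094189343519175229 / 23841857910156250000 * p ^ 7 * q ^ 8 +
      788715347366036057447564645848218623133 / 47683715820312500000 * p ^ 8 * q ^ 7 +
      1753367169065784242545861937622906924027 / 95367431640625000000 * p ^ 9 * q ^ 6 +
      8383959394296919909023186235440959285817 / 476837158203125000000 * p ^ 10 * q ^ 5 +
      3013849665250417231071018308027718181371 / 238418579101562500000 * p ^ 11 * q ^ 4 +
      152429376490548624091723079255060833773 / 23841857910156250000 * p ^ 12 * q ^ 3 +
      5107619417186376506598653002530788091 / 2384185791015625000 * p ^ 13 * q ^ 2 +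
      10195503141037851960942329415049041 / 23841857910156250 * p ^ 14 * q ^ 1 +
      459925971159040129674704377305312 / 11920928955078125 * p ^ 15 * q ^ 0 := by
    intro p q hp hq
    positivity
  refine sub_nonneg.1 ((key (-(19 / 20) - t) (t + 1) (by linarith) (by linarith)).trans_eq ?_)
  simp only [kissingPoly, capCofactor]
  ring

theorem kissingPoly_le {t : ℝ} (h₁ : -1 ≤ t) (h₂ : t ≤ -(3 / 4)) : kissingPoly t ≤ 0.0051 := by
  rcases le_total t (-(19 / 20)) with h | h
  · exact kissingPoly_le_of_le_neg_19_div_20 h₁ h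
  · exact (kissingPoly_le_of_neg_19_div_20_le h h₂).trans (by norm_num)

/-- The coefficients of `kissingPoly` in the basis of monic Gegenbauer polynomials. -/
noncomputable def kissingCoeff (k : ℕ) : ℝ :=
  [9703777822017444681974418854069940353 / 1786586914062500000000000000000000000000000,
    22180855066348230810617384424455627219 / 214390429687500000000000000000000000000000,
    67205127869121051439774687684126096703 / 71463476562500000000000000000000000000000,
    282149327256203516722200867273432252393 / 50517285156250000000000000000000000000000,
    256124002296071692853094721726414115109 / 10592333984375000000000000000000000000000,
    67359602495040464636779119044068296111 / 828127929687500000000000000000000000000,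
    1798529134979820665686062165217890851 / 8281279296875000000000000000000000000,
    104261928765208974074687805062959 / 223818359375000000000000000000000,
    3415977311248157621974584189 / 4304199218750000000000000000,
    32526060931484870723626149 / 31578125000000000000000000,
    280178569965676661751 / 293750000000000000000,
    3553285008354671 / 8225000000000000,
    607371 / 25000000000,
    74583 / 425000000,
    7497 / 10000,
    1].getD k 0

theorem kissingCoeff_nonneg (k : ℕ) : 0 ≤ kissingCoeff k := by
  rcases lt_or_ge k 16 with h | h
  · interval_cases k <;> norm_num [kissingCoeff]
  · simp [kissingCoeff, h]

theorem kissingPoly_eq_sum_gegenbauer (t : ℝ) :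
    kissingPoly t = ∑ k ∈ Finset.range 16, kissingCoeff k * gegenbauer 25 k t := by
  simp only [kissingPoly, capCofactor, kissingCoeff, gegenbauer, gegenbauerCoeff,
    Finset.sum_range_succ, Finset.sum_range_zero, List.getD_cons_zero, List.getD_cons_succ]
  norm_num [gegenbauerCoeff]
  ring

theorem kissingPoly_one_add_lt : kissingPoly 1 + 0.0051 < 278084 * kissingCoeff 0 := by
  norm_num [kissingPoly, capCofactor, kissingCoeff]

theorem kissingPoly_add_le_of_neg_23_div_25_le {a b : ℝ} (ha : -(23 / 25) ≤ a)
    (ha' : a ≤ -(3 / 4)) (hb : -(23 / 25) ≤ b) (hb' : b ≤ -(3 / 4))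
    (hab : a ^ 2 - a * b + b ^ 2 ≤ 3 / 4) : kissingPoly a + kissingPoly b ≤ 0.0051 := by
  have hs : -(a + b) ≤ 1.7321 := by nlinarith [sq_nonneg (a - b)]
  have h₁ := mul_le_mul_of_nonneg_left (capCofactor_le_of_neg_23_div_25_le ha ha')
    (show 0 ≤ -3 / 4 - a by linarith)
  have h₂ := mul_le_mul_of_nonneg_left (capCofactor_le_of_neg_23_div_25_le hb hb')
    (show 0 ≤ -3 / 4 - b by linarith)
  unfold kissingPoly
  linarith

theorem kissingPoly_add_le_of_le {a b : ℝ} (ha : -1 ≤ a) (hab : a ≤ b) (hb : b ≤ -(3 / 4))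
    (h : a ^ 2 - a * b + b ^ 2 ≤ 3 / 4) : kissingPoly a + kissingPoly b ≤ 0.0051 := by
  rcases le_total (-(23 / 25)) a with h' | h'
  · exact kissingPoly_add_le_of_neg_23_div_25_le h' (hab.trans hb) (h'.trans hab) hb h
  have hb' : -(4 / 5) ≤ b := by
    by_contra! hb'
    nlinarith [sq_nonneg (b - a / 2), mul_nonneg (sub_nonneg.2 hab) (sub_nonneg.2 h')]
  have ha' : -(19 / 20) ≤ a := by
    by_contra! ha'
    nlinarith [sq_nonneg (b - a / 2)]
  have h₁ := kissingPoly_le_of_neg_19_div_20_le ha' (hab.trans hb)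
  have h₂ := mul_le_mul_of_nonneg_left (capCofactor_le_of_neg_4_div_5_le hb' hb)
    (show 0 ≤ -3 / 4 - b by linarith)
  unfold kissingPoly at *
  linarith

theorem kissingPoly_add_le {a b : ℝ} (ha : -1 ≤ a) (ha' : a ≤ -(3 / 4)) (hb : -1 ≤ b)
    (hb' : b ≤ -(3 / 4)) (h : a ^ 2 - a * b + b ^ 2 ≤ 3 / 4) :
    kissingPoly a + kissingPoly b ≤ 0.0051 := by
  rcases le_total a b with hab | hab
  · exact kissingPoly_add_le_of_le ha hab hb' h
  · rw [add_comm]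
    exact kissingPoly_add_le_of_le hb hab ha' (by linarith)

section InnerProductSpace

variable {E : Type*} [NormedAddCommGroup E] [InnerProductSpace ℝ E]

theorem neg_one_le_inner_of_norm_eq_one {u v : E} (hu : ‖u‖ = 1) (hv : ‖v‖ = 1) :
    -1 ≤ ⟪u, v⟫ := by
  have h := neg_le_of_abs_le (abs_real_inner_le_norm u v)
  rwa [hu, hv, one_mul] at h

/-- The determinant of the Gram matrix of three unit vectors, two of which have inner product at
most `1 / 2` and are nearly opposite to the third one. -/
theorem inner_sq_sub_mul_add_sq_le {e u v : E} (he : ‖e‖ = 1) (hu : ‖u‖ = 1) (hv : ‖v‖ = 1)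
    (huv : ⟪u, v⟫ ≤ 1 / 2) (heu₁ : -1 ≤ ⟪e, u⟫) (heu : ⟪e, u⟫ ≤ -(3 / 4)) (hev₁ : -1 ≤ ⟪e, v⟫)
    (hev : ⟪e, v⟫ ≤ -(3 / 4)) :
    ⟪e, u⟫ ^ 2 - ⟪e, u⟫ * ⟪e, v⟫ + ⟪e, v⟫ ^ 2 ≤ 3 / 4 := by
  set a := ⟪e, u⟫ with ha
  set b := ⟪e, v⟫ with hb
  set p := (4 * a - 2 * b) / 3 with hp
  set q := (4 * b - 2 * a) / 3 with hq
  have key : ‖p • u + q • v - e‖ ^ 2 = p ^ 2 + q ^ 2 + 1 + 2 * (p * q * ⟪u, v⟫) - 2 * (p * a)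
      - 2 * (q * b) := by
    rw [norm_sub_sq_real, norm_add_sq_real, norm_smul, norm_smul, inner_add_left,
      real_inner_smul_left, real_inner_smul_right, real_inner_smul_left, real_inner_smul_left,
      real_inner_comm e u, real_inner_comm e v, he, hu, hv, mul_one, mul_one, ← ha, ← hb,
      Real.norm_eq_abs, Real.norm_eq_abs, sq_abs, sq_abs]
    ring
  have hpq : 0 ≤ p * q := mul_nonneg_of_nonpos_of_nonpos (by linarith) (by linarith)
  have h := (sq_nonneg ‖p • u + q • v - e‖).trans_eq key
  nlinarith [mul_le_mul_of_nonneg_left huv hpq]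

theorem norm_sum_sq_le {ι : Type*} [DecidableEq ι] (J : Finset ι) (x : ι → E)
    (hx : ∀ i ∈ J, ‖x i‖ = 1) (hsep : ∀ i ∈ J, ∀ j ∈ J, i ≠ j → ⟪x i, x j⟫ ≤ 1 / 2) :
    ‖∑ i ∈ J, x i‖ ^ 2 ≤ J.card * (J.card + 1) / 2 := by
  have h : ∀ i ∈ J, ∀ j ∈ J, ⟪x i, x j⟫ ≤ 1 / 2 + if i = j then 1 / 2 else 0 := by
    intro i hi j hj
    split_ifs with hij
    · rw [← hij, real_inner_self_eq_norm_sq, hx i hi]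
      norm_num
    · simpa using hsep i hi j hj hij
  calc ‖∑ i ∈ J, x i‖ ^ 2 = ∑ i ∈ J, ∑ j ∈ J, ⟪x i, x j⟫ := by
        rw [← real_inner_self_eq_norm_sq, sum_inner]
        simp_rw [inner_sum]
    _ ≤ ∑ i ∈ J, ∑ j ∈ J, (1 / 2 + if i = j then 1 / 2 else 0) :=
        Finset.sum_le_sum fun i hi => Finset.sum_le_sum fun j hj => h i hi j hj
    _ = J.card * (J.card + 1) / 2 := by
        simp [Finset.sum_add_distrib]
        ring

/-- The total contribution to the linear programming bound of the points in the spherical cap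
opposite to `e`. -/
theorem sum_kissingPoly_le {ι : Type*} [DecidableEq ι] {e : E} (he : ‖e‖ = 1) (J : Finset ι)
    (x : ι → E) (hx : ∀ i ∈ J, ‖x i‖ = 1)
    (hsep : ∀ i ∈ J, ∀ j ∈ J, i ≠ j → ⟪x i, x j⟫ ≤ 1 / 2)
    (hJ : ∀ j ∈ J, ⟪e, x j⟫ ≤ -(3 / 4)) : ∑ j ∈ J, kissingPoly ⟪e, x j⟫ ≤ 0.0051 := by
  have hJ' : ∀ j ∈ J, -1 ≤ ⟪e, x j⟫ := fun j hj => neg_one_le_inner_of_norm_eq_one he (hx j hj)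
  rcases lt_or_ge J.card 3 with h | h
  · interval_cases hc : J.card
    · rw [Finset.card_eq_zero.1 hc]
      norm_num
    · obtain ⟨j, rfl⟩ := Finset.card_eq_one.1 hc
      simpa using kissingPoly_le (hJ' j (by simp)) (hJ j (by simp))
    · obtain ⟨i, j, hij, rfl⟩ := Finset.card_eq_two.1 hc
      rw [Finset.sum_pair hij]
      have hi : i ∈ ({i, j} : Finset ι) := by simp
      have hj : j ∈ ({i, j} : Finset ι) := by simp
      exact kissingPoly_add_le (hJ' i hi) (hJ i hi) (hJ' j hj) (hJ j hj)
        (inner_sq_sub_mul_add_sq_le he (hx i hi) (hx j hj) (hsep i hi j hj hij) (hJ' i hi)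
          (hJ i hi) (hJ' j hj) (hJ j hj))
  · have hm : (3 : ℝ) ≤ J.card := mod_cast h
    have hsum : -∑ j ∈ J, ⟪e, x j⟫ ≤ ‖∑ j ∈ J, x j‖ := by
      have := neg_le_of_abs_le (abs_real_inner_le_norm e (∑ j ∈ J, x j))
      rw [he, one_mul, inner_sum] at this
      linarith
    have hnorm : ‖∑ j ∈ J, x j‖ ≤ 0.2 + 0.75 * J.card := by
      refine abs_le_of_sq_le_sq' ((norm_sum_sq_le J x hx hsep).trans ?_) (by positivity) |>.2
      nlinarith
    calc ∑ j ∈ J, kissingPoly ⟪e, x j⟫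
        ≤ ∑ j ∈ J, (-3 / 4 - ⟪e, x j⟫) * (5 * 0.0051) := Finset.sum_le_sum fun j hj =>
          mul_le_mul_of_nonneg_left (capCofactor_le (hJ' j hj) (hJ j hj)) (by linarith [hJ j hj])
      _ = (-∑ j ∈ J, ⟪e, x j⟫ - 0.75 * J.card) * (5 * 0.0051) := by
          rw [← Finset.sum_mul, Finset.sum_sub_distrib, Finset.sum_const, nsmul_eq_mul]
          ring
      _ ≤ 0.0051 := by linarith

theorem sum_kissingPoly_inner_le {ι : Type*} [Fintype ι] (x : ι → E) (hx : ∀ i, ‖x i‖ = 1)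
    (hsep : ∀ i j, i ≠ j → ⟪x i, x j⟫ ≤ 1 / 2) (i : ι) :
    ∑ j, kissingPoly ⟪x i, x j⟫ ≤ kissingPoly 1 + 0.0051 := by
  classical
  rw [← Finset.add_sum_erase _ _ (Finset.mem_univ i), real_inner_self_eq_norm_sq, hx, one_pow,
    ← Finset.sum_filter_add_sum_filter_not _ fun j => ⟪x i, x j⟫ ≤ -(3 / 4)]
  have hcap := sum_kissingPoly_le (hx i)
    {j ∈ Finset.univ.erase i | ⟪x i, x j⟫ ≤ -(3 / 4)} x (fun j _ => hx j)
    (fun j _ k _ => hsep j k) fun j hj => (Finset.mem_filter.1 hj).2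
  have hrest : ∑ j ∈ Finset.univ.erase i with ¬⟪x i, x j⟫ ≤ -(3 / 4),
      kissingPoly ⟪x i, x j⟫ ≤ 0 := by
    refine Finset.sum_nonpos fun j hj => ?_
    rw [Finset.mem_filter, Finset.mem_erase, not_le] at hj
    exact kissingPoly_nonpos hj.2.le (hsep i j hj.1.1.symm)
  linarith

end InnerProductSpace

/-- The kissing number in dimension 25 is at most 278083. -/
theorem kissing_dim25_le (N : ℕ)
    (x : Fin N → EuclideanSpace ℝ (Fin 25))
    (hx : ∀ i, ‖x i‖ = 1)
    (hsep : ∀ i j, i ≠ j → ⟪x i, x j⟫ ≤ 1 / 2) :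
    N ≤ 278083 := by
  rcases N.eq_zero_or_pos with rfl | hN
  · exact Nat.zero_le _
  have hgeg : ∀ k, 0 ≤ ∑ i, ∑ j, gegenbauer 25 k ⟪x i, x j⟫ := by
    intro k
    have h := sum_gegenbauer_nonneg k (fun i s => x i s) fun i => by
      rw [← EuclideanSpace.real_norm_sq_eq, hx, one_pow]
    simpa [PiLp.inner_apply, mul_comm] using h
  have hgeg₀ : ∑ i, ∑ j, gegenbauer 25 0 ⟪x i, x j⟫ = (N : ℝ) * N := by
    simp [gegenbauer, gegenbauerCoeff]
  have hlower : kissingCoeff 0 * (N * N) ≤ ∑ i, ∑ j, kissingPoly ⟪x i, x j⟫ := by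
    have hswap : ∑ i, ∑ j, kissingPoly ⟪x i, x j⟫ =
        ∑ k ∈ Finset.range 16, kissingCoeff k * ∑ i, ∑ j, gegenbauer 25 k ⟪x i, x j⟫ := by
      simp_rw [kissingPoly_eq_sum_gegenbauer, Finset.mul_sum]
      rw [Finset.sum_comm (s := Finset.range 16)]
      exact Finset.sum_congr rfl fun i _ => Finset.sum_comm
    rw [hswap, ← hgeg₀]
    exact Finset.single_le_sum
      (f := fun k => kissingCoeff k * ∑ i, ∑ j, gegenbauer 25 k ⟪x i, x j⟫)
      (fun k _ => mul_nonneg (kissingCoeff_nonneg k) (hgeg k)) (by simp)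
  have hupper : ∑ i, ∑ j, kissingPoly ⟪x i, x j⟫ ≤ N * (kissingPoly 1 + 0.0051) := by
    refine (Finset.sum_le_sum fun i _ => sum_kissingPoly_inner_le x hx hsep i).trans_eq ?_
    rw [Finset.sum_const, Finset.card_univ, Fintype.card_fin, nsmul_eq_mul]
  have hN' : (0 : ℝ) < N := mod_cast hN
  have hle : kissingCoeff 0 * N ≤ kissingPoly 1 + 0.0051 :=
    le_of_mul_le_mul_left (by linarith) hN'
  have hc : 0 ≤ kissingCoeff 0 := kissingCoeff_nonneg 0
  have hlt : (N : ℝ) < 278084 :=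
    lt_of_mul_lt_mul_left (hle.trans_lt (kissingPoly_one_add_lt.trans_eq (mul_comm _ _))) hc
  have : N < 278084 := mod_cast hlt
  omega
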